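/- Let γ ∈ ℂ. There is r0 ∈ (0,1) such that for every r ∈ (0,r0), every y ∈ ℤ, and all integers x1 ≤ x2: ∮_{|z1|=r} ∮_{|z2|=1} (s(z1)−s(z2))/(s(z1)−s(z2)−2γ) · z2^{x1−y} z1^{x2−y} dz2/(2πiz2) dz1/(2πiz1) = 𝟙[x1=y]·𝟙[x2=y]. -/

import Mathlib

/-- `∮_{|z|=ρ} f(z) dz/(2πiz)`: the normalized contour integral over the counterclockwise
circle of radius `ρ` centered at the origin. -/
noncomputable def cint (ρ : ℝ) (f : ℂ → ℂ) : ℂ :=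
  (2 * Real.pi * Complex.I)⁻¹ * (∮ z in C(0, ρ), f z / z)

/-- `s(z) = (z - 1/z)/(2i)`. -/
noncomputable def sfun (z : ℂ) : ℂ := (z - z⁻¹) / (2 * Complex.I)

theorem cint_eq_intervalIntegral {ρ : ℝ} (hρ : 0 < ρ) (f : ℂ → ℂ) :
    cint ρ f = (2 * Real.pi : ℂ)⁻¹ * ∫ θ in (0 : ℝ)..2 * Real.pi, f (circleMap 0 ρ θ) := by
  have h : (∮ z in C(0, ρ), f z / z) =
      Complex.I * ∫ θ in (0 : ℝ)..2 * Real.pi, f (circleMap 0 ρ θ) := by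
    rw [circleIntegral, ← intervalIntegral.integral_const_mul]
    refine intervalIntegral.integral_congr fun θ _ => ?_
    have hz : circleMap 0 ρ θ ≠ 0 := circleMap_ne_center hρ.ne'
    simp only [deriv_circleMap, smul_eq_mul]
    field_simp
  rw [cint, h]
  field_simp

theorem cint_congr {ρ : ℝ} (hρ : 0 ≤ ρ) {f g : ℂ → ℂ}
    (h : Set.EqOn f g (Metric.sphere 0 ρ)) : cint ρ f = cint ρ g := by
  rw [cint, cint, circleIntegral.integral_congr hρ fun z hz => ?_]
  simp only [h hz]

theorem cint_const_mul (ρ : ℝ) (c : ℂ) (f : ℂ → ℂ) :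
    cint ρ (fun z => c * f z) = c * cint ρ f := by
  simp only [cint, mul_div_assoc, circleIntegral.integral_const_mul]
  ring

theorem circleIntegrable_div_self {ρ : ℝ} (hρ : 0 < ρ) {f : ℂ → ℂ}
    (hf : ContinuousOn f (Metric.sphere 0 ρ)) : CircleIntegrable (fun z => f z / z) 0 ρ :=
  (hf.div continuousOn_id fun _ hz =>
    ne_zero_of_mem_sphere hρ.ne' ⟨_, hz⟩).circleIntegrable hρ.le

theorem cint_add {ρ : ℝ} (hρ : 0 < ρ) {f g : ℂ → ℂ} (hf : ContinuousOn f (Metric.sphere 0 ρ))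
    (hg : ContinuousOn g (Metric.sphere 0 ρ)) :
    cint ρ (fun z => f z + g z) = cint ρ f + cint ρ g := by
  simp only [cint, add_div]
  rw [circleIntegral.integral_add (circleIntegrable_div_self hρ hf)
    (circleIntegrable_div_self hρ hg), mul_add]

theorem cint_zpow {ρ : ℝ} (hρ : 0 < ρ) (k : ℤ) :
    cint ρ (fun z => z ^ k) = if k = 0 then 1 else 0 := by
  have h : cint ρ (fun z => z ^ k) =
      (2 * Real.pi * Complex.I)⁻¹ * ∮ z in C(0, ρ), (z - 0) ^ (k - 1) := by
    rw [cint, circleIntegral.integral_congr hρ.le fun z hz => ?_]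
    have hz0 : z ≠ 0 := ne_zero_of_mem_sphere hρ.ne' ⟨z, hz⟩
    simp [zpow_sub_one₀ hz0, div_eq_mul_inv]
  rw [h]
  split_ifs with hk
  · subst hk
    simp only [zero_sub, zpow_neg_one]
    rw [circleIntegral.integral_sub_center_inv _ hρ.ne', inv_mul_cancel₀ Complex.two_pi_I_ne_zero]
  · rw [circleIntegral.integral_sub_zpow_of_ne (by omega), mul_zero]

/-- Fubini's theorem for a continuous function on a product of two circles. -/
theorem cint_cint_swap {ρ σ : ℝ} (hρ : 0 < ρ) (hσ : 0 < σ) {f : ℂ → ℂ → ℂ}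
    (hf : ContinuousOn (Function.uncurry f) (Metric.sphere 0 ρ ×ˢ Metric.sphere 0 σ)) :
    cint ρ (fun z => cint σ (f z)) = cint σ (fun w => cint ρ fun z => f z w) := by
  simp only [cint_eq_intervalIntegral hρ, cint_eq_intervalIntegral hσ,
    intervalIntegral.integral_const_mul]
  rw [MeasureTheory.intervalIntegral_intervalIntegral_swap]
  have hc : Continuous (Function.uncurry fun θ φ : ℝ =>
      f (circleMap 0 ρ θ) (circleMap 0 σ φ)) := by
    refine hf.comp_continuous (f := fun p : ℝ × ℝ => (circleMap 0 ρ p.1, circleMap 0 σ p.2))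
      (by fun_prop) fun p => ?_
    exact ⟨circleMap_mem_sphere _ hρ.le _, circleMap_mem_sphere _ hσ.le _⟩
  exact (hc.continuousOn.integrableOn_compact
    (isCompact_uIcc.prod isCompact_uIcc)).mono_set
    (Set.prod_mono Set.uIoc_subset_uIcc Set.uIoc_subset_uIcc)

theorem continuousOn_sfun : ContinuousOn sfun {0}ᶜ := by
  unfold sfun
  exact (continuousOn_id.sub continuousOn_inv₀).div_const _

/-- `s(z) + c` has only the powers `z`, `1`, `z⁻¹`, so `(s(z) + c)^n z^k` has no constant term
when `k < -n`. -/
theorem cint_zpow_mul_sfun_add_pow (c : ℂ) (n : ℕ) {k : ℤ} (h : k + n < 0) :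
    cint 1 (fun z => z ^ k * (sfun z + c) ^ n) = 0 := by
  have hsub : Metric.sphere (0 : ℂ) 1 ⊆ {0}ᶜ := fun z hz =>
    ne_zero_of_mem_sphere one_ne_zero ⟨z, hz⟩
  have hs := continuousOn_sfun.mono hsub
  have hcont (k : ℤ) (n : ℕ) :
      ContinuousOn (fun z : ℂ => z ^ k * (sfun z + c) ^ n) (Metric.sphere 0 1) :=
    (continuousOn_id.zpow₀ k fun z hz => Or.inl (hsub hz)).mul
      ((hs.add continuousOn_const).pow n)
  induction n generalizing k with
  | zero =>
    simp only [pow_zero, mul_one]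
    rw [cint_zpow one_pos, if_neg (by omega)]
  | succ n ih =>
    have hexp : cint 1 (fun z => z ^ k * (sfun z + c) ^ (n + 1)) =
        cint 1 (fun z => (2 * Complex.I)⁻¹ * (z ^ (k + 1) * (sfun z + c) ^ n) +
          ((-(2 * Complex.I)⁻¹) * (z ^ (k - 1) * (sfun z + c) ^ n) +
            c * (z ^ k * (sfun z + c) ^ n))) := by
      refine cint_congr zero_le_one fun z hz => ?_
      have hz0 : z ≠ 0 := hsub hz
      simp only [zpow_add_one₀ hz0, zpow_sub_one₀ hz0, pow_succ]
      generalize hp : (sfun z + c) ^ n = p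
      rw [sfun, div_eq_mul_inv]
      ring
    push_cast at h
    rw [hexp, cint_add one_pos, cint_add one_pos, cint_const_mul, cint_const_mul, cint_const_mul,
      ih (by omega), ih (by omega), ih (by omega)]
    · ring
    · exact continuousOn_const.mul (hcont _ _)
    · exact continuousOn_const.mul (hcont _ _)
    · exact continuousOn_const.mul (hcont _ _)
    · exact (continuousOn_const.mul (hcont _ _)).add (continuousOn_const.mul (hcont _ _))

/-- Partial geometric expansion of the resolvent: the first `N` terms integrate to zero. -/
theorem cint_zpow_mul_resolvent (c s : ℂ) (hs0 : s ≠ 0)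
    (hs : ∀ z ∈ Metric.sphere (0 : ℂ) 1, s - (sfun z + c) ≠ 0) (a : ℤ) (N : ℕ)
    (h : N ≤ (-a).toNat) :
    cint 1 (fun z => z ^ a / (s - (sfun z + c))) =
      cint 1 (fun z => z ^ a * (sfun z + c) ^ N / s ^ N / (s - (sfun z + c))) := by
  have hsub : Metric.sphere (0 : ℂ) 1 ⊆ {0}ᶜ := fun z hz =>
    ne_zero_of_mem_sphere one_ne_zero ⟨z, hz⟩
  have hsc := continuousOn_sfun.mono hsub
  have hcont (n : ℕ) :
      ContinuousOn (fun z : ℂ => z ^ a * (sfun z + c) ^ n) (Metric.sphere 0 1) :=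
    (continuousOn_id.zpow₀ a fun z hz => Or.inl (hsub hz)).mul
      ((hsc.add continuousOn_const).pow n)
  induction N with
  | zero => simp
  | succ n ih =>
    have hexp : cint 1 (fun z => z ^ a * (sfun z + c) ^ n / s ^ n / (s - (sfun z + c))) =
        cint 1 (fun z => (s ^ (n + 1))⁻¹ * (z ^ a * (sfun z + c) ^ n) +
          z ^ a * (sfun z + c) ^ (n + 1) / s ^ (n + 1) / (s - (sfun z + c))) := by
      refine cint_congr zero_le_one fun z hz => ?_
      have h1 := hs z hz
      generalize sfun z + c = t at *
      field_simp
      ring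
    rw [ih (by omega), hexp, cint_add one_pos, cint_const_mul,
      cint_zpow_mul_sfun_add_pow c n (by omega), mul_zero, zero_add]
    · exact continuousOn_const.mul (hcont n)
    · exact ((hcont (n + 1)).div_const _).div
        (continuousOn_const.sub (hsc.add continuousOn_const)) hs

theorem sfun_eq_div {z : ℂ} (hz : z ≠ 0) : sfun z = (z ^ 2 - 1) / (2 * Complex.I * z) := by
  rw [sfun]
  field_simp

theorem sfun_sub_eq_div {z : ℂ} (hz : z ≠ 0) (t : ℂ) :
    sfun z - t = (z ^ 2 - 1 - 2 * Complex.I * t * z) / (2 * Complex.I * z) := by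
  rw [sfun_eq_div hz]
  field_simp

theorem sq_sub_one_sub_ne_zero {z t : ℂ} (h : ‖z‖ ^ 2 + 2 * ‖t‖ * ‖z‖ < 1) :
    z ^ 2 - 1 - 2 * Complex.I * t * z ≠ 0 := by
  intro h0
  have h1 : (1 : ℂ) = z ^ 2 - 2 * Complex.I * t * z := by linear_combination -h0
  have h2 := norm_sub_le (z ^ 2) (2 * Complex.I * t * z)
  rw [← h1] at h2
  simp only [norm_mul, norm_pow, norm_one, Complex.norm_I, Complex.norm_ofNat, mul_one] at h2
  linarith

theorem sfun_sub_ne_zero {z t : ℂ} (hz : z ≠ 0) (h : ‖z‖ ^ 2 + 2 * ‖t‖ * ‖z‖ < 1) :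
    sfun z - t ≠ 0 := by
  rw [sfun_sub_eq_div hz]
  exact div_ne_zero (sq_sub_one_sub_ne_zero h)
    (mul_ne_zero (mul_ne_zero two_ne_zero Complex.I_ne_zero) hz)

/-- Cauchy's theorem: `1 / s(z)` and `1 / (s(z) - t)` extend holomorphically by zero to the
origin, so the remainder of the geometric expansion integrates to zero over a small circle. -/
theorem cint_zpow_div_sfun_pow_div {r : ℝ} (hr : 0 < r) {t : ℂ} (h : r ^ 2 + 2 * ‖t‖ * r < 1)
    {b : ℤ} {N : ℕ} (hb : 0 ≤ b + N) :
    cint r (fun z => z ^ b / sfun z ^ N / (sfun z - t)) = 0 := by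
  obtain ⟨m, hm⟩ := Int.eq_ofNat_of_zero_le hb
  have hne (t' : ℂ) (ht' : ‖t'‖ ≤ ‖t‖) : ∀ z ∈ Metric.closedBall (0 : ℂ) r,
      z ^ 2 - 1 - 2 * Complex.I * t' * z ≠ 0 := fun z hz => by
    have hz' : ‖z‖ ≤ r := by simpa using hz
    refine sq_sub_one_sub_ne_zero (lt_of_le_of_lt ?_ h)
    gcongr
  have hne0 : ∀ z ∈ Metric.closedBall (0 : ℂ) r, z ^ 2 - 1 ≠ 0 := by
    simpa using hne 0 (by simp)
  have hne1 := hne t le_rfl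
  rw [cint, circleIntegral.integral_congr (g := fun z => (2 * Complex.I) ^ (N + 1) * z ^ m /
    (z ^ 2 - 1) ^ N / (z ^ 2 - 1 - 2 * Complex.I * t * z)) hr.le fun z hz => ?_]
  · rw [DiffContOnCl.circleIntegral_eq_zero hr.le, mul_zero]
    refine DifferentiableOn.diffContOnCl_ball (U := Metric.closedBall 0 r) ?_ subset_rfl
    intro z hz
    have h0 := pow_ne_zero N (hne0 z hz)
    have h1 := hne1 z hz
    exact DifferentiableAt.differentiableWithinAt (by fun_prop (disch := assumption))
  · have hz0 : z ≠ 0 := ne_zero_of_mem_sphere hr.ne' ⟨z, hz⟩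
    have hzb := Metric.sphere_subset_closedBall hz
    have h0 := hne0 z hzb
    have h1 := hne1 z hzb
    have hpow : z ^ m = z ^ b * z ^ N := by
      rw [← zpow_natCast, ← zpow_natCast, ← zpow_add₀ hz0, hm]
    simp only
    rw [sfun_sub_eq_div hz0, sfun_eq_div hz0, hpow, div_pow, mul_pow, pow_succ (2 * Complex.I)]
    field_simp

theorem norm_sfun_le_one {z : ℂ} (hz : ‖z‖ = 1) : ‖sfun z‖ ≤ 1 := by
  have h := norm_sub_le z z⁻¹
  rw [norm_inv, hz] at h
  rw [sfun, norm_div]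
  simp only [norm_mul, Complex.norm_I, Complex.norm_ofNat]
  linarith

/-- The bound-state contour integral evaluates to the double Kronecker delta
`𝟙[x1=y]·𝟙[x2=y]` for ordered positions `x1 ≤ x2`. -/
theorem bound_state_delta (γ : ℂ) :
    ∃ r0 ∈ Set.Ioo (0 : ℝ) 1, ∀ r ∈ Set.Ioo (0 : ℝ) r0, ∀ (y x1 x2 : ℤ), x1 ≤ x2 →
      (cint r fun z1 => cint 1 fun z2 =>
        ((sfun z1 - sfun z2) / (sfun z1 - sfun z2 - 2 * γ)) *
          (z2 ^ (x1 - y) * z1 ^ (x2 - y))) =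
      (if x1 = y then 1 else 0) * (if x2 = y then 1 else 0) := by
  have hM : 0 < 4 * (1 + 2 * ‖γ‖) := by positivity
  refine ⟨(4 * (1 + 2 * ‖γ‖))⁻¹, ⟨inv_pos.2 hM, inv_lt_one_of_one_lt₀ ?_⟩, ?_⟩
  · linarith [norm_nonneg γ]
  rintro r ⟨hr, hr'⟩ y x1 x2 hx
  have hr1 : (1 + 2 * ‖γ‖) * r < 1 / 4 := by
    rw [lt_inv_comm₀ hr hM, ← one_div, lt_div_iff₀ hr] at hr'
    linarith
  have hsmall : r ^ 2 + 2 * (1 + 2 * ‖γ‖) * r < 1 := by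
    nlinarith [norm_nonneg γ, mul_nonneg (norm_nonneg γ) hr.le]
  have hsmall' {t : ℂ} (ht : ‖t‖ ≤ 1 + 2 * ‖γ‖) : r ^ 2 + 2 * ‖t‖ * r < 1 := by
    refine lt_of_le_of_lt ?_ hsmall
    gcongr
  have ht {z2 : ℂ} (hz2 : z2 ∈ Metric.sphere (0 : ℂ) 1) :
      ‖sfun z2 + 2 * γ‖ ≤ 1 + 2 * ‖γ‖ := by
    refine (norm_add_le _ _).trans (add_le_add (norm_sfun_le_one (by simpa using hz2)) ?_)
    simp
  have hzr {z1 : ℂ} (hz1 : z1 ∈ Metric.sphere (0 : ℂ) r) : z1 ≠ 0 :=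
    ne_zero_of_mem_sphere hr.ne' ⟨z1, hz1⟩
  have hz_one {z2 : ℂ} (hz2 : z2 ∈ Metric.sphere (0 : ℂ) 1) : z2 ≠ 0 :=
    ne_zero_of_mem_sphere one_ne_zero ⟨z2, hz2⟩
  have hsub {z1 t : ℂ} (hz1 : z1 ∈ Metric.sphere (0 : ℂ) r) (ht : ‖t‖ ≤ 1 + 2 * ‖γ‖) :
      sfun z1 - t ≠ 0 := by
    refine sfun_sub_ne_zero (hzr hz1) ?_
    rw [mem_sphere_zero_iff_norm.1 hz1]
    exact hsmall' ht
  have hs0 {z1 : ℂ} (hz1 : z1 ∈ Metric.sphere (0 : ℂ) r) : sfun z1 ≠ 0 := by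
    simpa using hsub (t := 0) hz1 (by rw [norm_zero]; positivity)
  set a := x1 - y with ha
  set b := x2 - y with hb
  set N := (-a).toNat with hN
  have hs1 := continuousOn_sfun.mono (fun z hz => hz_one hz : Metric.sphere (0 : ℂ) 1 ⊆ {0}ᶜ)
  have hsr := continuousOn_sfun.mono (fun z hz => hzr hz : Metric.sphere (0 : ℂ) r ⊆ {0}ᶜ)
  have hzpow1 (k : ℤ) : ContinuousOn (fun z : ℂ => z ^ k) (Metric.sphere 0 1) :=
    continuousOn_id.zpow₀ k fun z hz => Or.inl (hz_one hz)
  have hzpowr (k : ℤ) : ContinuousOn (fun z : ℂ => z ^ k) (Metric.sphere 0 r) :=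
    continuousOn_id.zpow₀ k fun z hz => Or.inl (hzr hz)
  let K : ℂ → ℂ → ℂ := fun z1 z2 => 2 * γ * (z2 ^ a * (sfun z2 + 2 * γ) ^ N) *
    (z1 ^ b / sfun z1 ^ N / (sfun z1 - (sfun z2 + 2 * γ)))
  have hK : ContinuousOn (Function.uncurry K) (Metric.sphere 0 r ×ˢ Metric.sphere 0 1) := by
    have hfst {f : ℂ → ℂ} (hf : ContinuousOn f (Metric.sphere 0 r)) :
        ContinuousOn (fun p : ℂ × ℂ => f p.1) (Metric.sphere 0 r ×ˢ Metric.sphere 0 1) :=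
      hf.comp continuousOn_fst fun p hp => hp.1
    have hsnd {f : ℂ → ℂ} (hf : ContinuousOn f (Metric.sphere 0 1)) :
        ContinuousOn (fun p : ℂ × ℂ => f p.2) (Metric.sphere 0 r ×ˢ Metric.sphere 0 1) :=
      hf.comp continuousOn_snd fun p hp => hp.2
    have ht_cont := (hsnd hs1).add (continuousOn_const (c := 2 * γ))
    refine (continuousOn_const.mul ((hsnd (hzpow1 a)).mul (ht_cont.pow N))).mul
      (((hfst (hzpowr b)).div ((hfst hsr).pow N) ?_).div ((hfst hsr).sub ht_cont) ?_)
    · exact fun p hp => pow_ne_zero N (hs0 hp.1)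
    · exact fun p hp => hsub hp.1 (ht hp.2)
  have hmono : ContinuousOn (Function.uncurry fun z1 z2 : ℂ => z2 ^ a * z1 ^ b)
      (Metric.sphere 0 r ×ˢ Metric.sphere 0 1) :=
    ((hzpow1 a).comp continuousOn_snd fun p hp => hp.2).mul
      ((hzpowr b).comp continuousOn_fst fun p hp => hp.1)
  have hslice {f : ℂ → ℂ → ℂ}
      (hf : ContinuousOn (Function.uncurry f) (Metric.sphere 0 r ×ˢ Metric.sphere 0 1))
      {z1 : ℂ} (hz1 : z1 ∈ Metric.sphere (0 : ℂ) r) :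
      ContinuousOn (f z1) (Metric.sphere 0 1) :=
    hf.comp (continuousOn_const.prodMk continuousOn_id) fun z2 hz2 => ⟨hz1, hz2⟩
  have hslice' {f : ℂ → ℂ → ℂ}
      (hf : ContinuousOn (Function.uncurry f) (Metric.sphere 0 r ×ˢ Metric.sphere 0 1))
      {z2 : ℂ} (hz2 : z2 ∈ Metric.sphere (0 : ℂ) 1) :
      ContinuousOn (fun z1 => f z1 z2) (Metric.sphere 0 r) :=
    hf.comp (continuousOn_id.prodMk continuousOn_const) fun z1 hz1 => ⟨hz1, hz2⟩
  have hinner {z1 : ℂ} (hz1 : z1 ∈ Metric.sphere (0 : ℂ) r) :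
      cint 1 (fun z2 => ((sfun z1 - sfun z2) / (sfun z1 - sfun z2 - 2 * γ)) *
        (z2 ^ a * z1 ^ b)) = cint 1 (fun z2 => z2 ^ a * z1 ^ b + K z1 z2) := by
    have hresolvent := cint_zpow_mul_resolvent (2 * γ) (sfun z1) (hs0 hz1)
      (fun z2 hz2 => hsub hz1 (ht hz2)) a N le_rfl
    have hKeq : cint 1 (K z1) =
        2 * γ * z1 ^ b * cint 1 (fun z2 => z2 ^ a / (sfun z1 - (sfun z2 + 2 * γ))) := by
      rw [hresolvent, ← cint_const_mul]
      refine cint_congr zero_le_one fun z2 _ => ?_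
      simp only [K]
      ring
    rw [cint_add one_pos (hslice hmono hz1) (hslice hK hz1), hKeq, ← cint_const_mul,
      ← cint_add one_pos (hslice hmono hz1)]
    · refine cint_congr zero_le_one fun z2 hz2 => ?_
      have h := hsub hz1 (ht hz2)
      simp only [sub_sub]
      field_simp
      ring
    · exact continuousOn_const.mul ((hzpow1 a).div (continuousOn_const.sub
        (hs1.add continuousOn_const)) fun z2 hz2 => hsub hz1 (ht hz2))
  have houter {z2 : ℂ} (hz2 : z2 ∈ Metric.sphere (0 : ℂ) 1) :
      cint r (fun z1 => z2 ^ a * z1 ^ b + K z1 z2) = (if b = 0 then 1 else 0) * z2 ^ a := by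
    rw [cint_add hr (hslice' hmono hz2) (hslice' hK hz2), cint_const_mul, cint_const_mul,
      cint_zpow hr, cint_zpow_div_sfun_pow_div hr (hsmall' (ht hz2)) (by omega)]
    ring
  rw [cint_congr hr.le fun z1 hz1 => hinner hz1,
    cint_cint_swap (f := fun z1 z2 => z2 ^ a * z1 ^ b + K z1 z2) hr one_pos (hmono.add hK),
    cint_congr zero_le_one fun z2 hz2 => houter hz2, cint_const_mul, cint_zpow one_pos, mul_comm]
  simp only [ha, hb, sub_eq_zero]
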